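/- Bounded chaos projections on the good parameter set (Proposition B.9). Fix an integer D ≥ 2 and constants C₀, C₆ > 0, c₆ ∈ (0,1/2). Let w₁,…,w_p be i.i.d. uniform on the unit sphere S^{d−1} with 1 ≤ p ≤ C₀d², stacked as rows of W ∈ ℝ^{p×d}, and let μ₁,…,μ_D ∈ ℝ be any real numbers satisfying d^{−c₆}/C₆ ≤ |μ₁| ≤ C₆d^{−c₆} and |μ_k| ≤ (log d)^{C₆} for 2 ≤ k ≤ D. Then for any constants C, K > 0 there exist constants K', d₀ > 0 (depending only on D, C₀, C₆, c₆, C, K) such that for all d ≥ d₀, with probability at least 1 − d^{−C} over the w_i: every θ ∈ Θ^PG_W(K) satisfies ‖μ_k·V_kᵀθ‖₂ ≤ (log d)^{K'} for each k = 2, …, D. -/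

import Mathlib

/-!
Bounded chaos projections on the good parameter set (Proposition B.9).
-/

noncomputable section

open MeasureTheory ProbabilityTheory

/-- Multi-indices on `Fin d` of total degree `k`. -/
abbrev MIdx (d k : ℕ) : Type :=
  {κ : Fin d → ℕ // κ ∈ Finset.Nat.antidiagonalTuple d k}

/-- Euclidean norm on `ι → ℝ`. -/
def enorm2 {ι : Type*} [Fintype ι] (u : ι → ℝ) : ℝ := Real.sqrt (∑ i, (u i) ^ 2)

/-- The standard Gaussian measure on `ι → ℝ`. -/
def stdG (ι : Type*) [Fintype ι] : Measure (ι → ℝ) :=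
  Measure.pi fun _ => gaussianReal 0 1

/-- The uniform distribution on the unit sphere of `ι → ℝ`. -/
def unifSphere (ι : Type*) [Fintype ι] : Measure (ι → ℝ) :=
  (stdG ι).map fun x => (enorm2 x)⁻¹ • x

/-- The vector `q_k(w)`. -/
def qvec (d k : ℕ) (w : Fin d → ℝ) : MIdx d k → ℝ :=
  fun κ => Real.sqrt ((Nat.factorial k : ℝ) / ∏ i, (Nat.factorial (κ.1 i) : ℝ)) *
    ∏ i, (w i) ^ (κ.1 i)

/-- The constrained parameter set `Θ^PG_W(K)`. -/
def ThetaPG (d p : ℕ) (K μ1 : ℝ) (w : Fin p → Fin d → ℝ) : Set (Fin p → ℝ) :=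
  {θ | (∀ j, |θ j| ≤ Real.log d ^ K * (d : ℝ) ^ (-(1 / 4 : ℝ))) ∧
    enorm2 θ ≤ Real.log d ^ K ∧
    |∑ j, θ j| ≤ Real.log d ^ K ∧
    enorm2 (fun i : Fin d => μ1 * ∑ j, w j i * θ j) ≤ Real.log d ^ K}

open Matrix in
theorem spec_data {ι : Type*} [Fintype ι] [DecidableEq ι] (T : Matrix ι ι ℝ) (hT : T.PosSemidef) :
    ∃ (U : ι → ι → ℝ) (l : ι → ℝ), (∀ i, 0 ≤ l i) ∧ (∀ i, ∑ k, U i k ^ 2 = 1) ∧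
      (∀ (n : ℕ) (x : ι → ℝ), x ⬝ᵥ (T ^ n *ᵥ x) = ∑ i, l i ^ n * (U i ⬝ᵥ x) ^ 2) ∧
      (∀ n : ℕ, (T ^ n).trace = ∑ i, l i ^ n) := by
  set hA := hT.isHermitian
  set V : Matrix ι ι ℝ := (hA.eigenvectorUnitary : Matrix ι ι ℝ) with hV
  have hVV : Vᵀ * V = 1 := by
    have := Unitary.coe_star_mul_self hA.eigenvectorUnitary
    simpa [star_eq_conjTranspose, conjTranspose_eq_transpose_of_trivial] using this
  have hVV' : V * Vᵀ = 1 := by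
    have := Unitary.coe_mul_star_self hA.eigenvectorUnitary
    simpa [star_eq_conjTranspose, conjTranspose_eq_transpose_of_trivial] using this
  have hspec : T = V * diagonal hA.eigenvalues * Vᵀ := by
    have := hA.spectral_theorem
    simpa [Unitary.conjStarAlgAut_apply, star_eq_conjTranspose, conjTranspose_eq_transpose_of_trivial, Function.comp_def] using this
  have hpow : ∀ n : ℕ, T ^ n = V * diagonal (fun i => hA.eigenvalues i ^ n) * Vᵀ := by
    intro n
    induction n with
    | zero => simp [hVV']
    | succ n ih =>
      have hs2 : T ^ (n + 1) = (V * diagonal (fun i => hA.eigenvalues i ^ n) * Vᵀ) *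
          (V * diagonal hA.eigenvalues * Vᵀ) := by
        rw [← hspec, ← ih, pow_succ]
      rw [hs2]
      calc _ = V * diagonal (fun i => hA.eigenvalues i ^ n) * (Vᵀ * V) * diagonal hA.eigenvalues * Vᵀ := by
            simp only [Matrix.mul_assoc]
        _ = _ := by
            rw [hVV, Matrix.mul_one, Matrix.mul_assoc V, diagonal_mul_diagonal]
            simp only [pow_succ]
  refine ⟨fun i => Vᵀ i, hA.eigenvalues, hT.eigenvalues_nonneg, ?_, ?_, ?_⟩
  · intro i
    have := congrFun (congrFun hVV i) i
    rw [Matrix.mul_apply] at this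
    simpa [sq] using this
  · intro n x
    rw [hpow, ← mulVec_mulVec, ← mulVec_mulVec, dotProduct_mulVec, ← mulVec_transpose]
    simp only [dotProduct, mulVec_diagonal]
    refine Finset.sum_congr rfl fun i _ => ?_
    have : (Vᵀ *ᵥ x) i = ∑ j, Vᵀ i j * x j := rfl
    rw [this]; ring
  · intro n
    rw [hpow, trace_mul_comm, ← Matrix.mul_assoc, hVV, Matrix.one_mul]
    simp [trace]

/-- moments -/
theorem cheb {ι : Type*} [Fintype ι] (l c : ι → ℝ) (hl : ∀ i, 0 ≤ l i) (hc : ∀ i, 0 ≤ c i)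
    (h1 : ∑ i, c i ≤ 1) (a b : ℕ) :
    (∑ i, l i ^ a * c i) * (∑ i, l i ^ b * c i) ≤ ∑ i, l i ^ (a + b) * c i := by
  have key : 0 ≤ ∑ i, ∑ j, c i * c j * ((l i ^ a - l j ^ a) * (l i ^ b - l j ^ b)) := by
    refine Finset.sum_nonneg fun i _ => Finset.sum_nonneg fun j _ => ?_
    refine mul_nonneg (mul_nonneg (hc i) (hc j)) ?_
    rcases le_total (l i) (l j) with h | h
    · exact mul_nonneg_of_nonpos_of_nonpos (sub_nonpos.2 (pow_le_pow_left₀ (hl i) h a))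
        (sub_nonpos.2 (pow_le_pow_left₀ (hl i) h b))
    · exact mul_nonneg (sub_nonneg.2 (pow_le_pow_left₀ (hl j) h a))
        (sub_nonneg.2 (pow_le_pow_left₀ (hl j) h b))
  have e : ∑ i, ∑ j, c i * c j * ((l i ^ a - l j ^ a) * (l i ^ b - l j ^ b))
      = 2 * ((∑ i, l i ^ (a + b) * c i) * ∑ i, c i)
        - 2 * ((∑ i, l i ^ a * c i) * (∑ i, l i ^ b * c i)) := by
    have e1 : ∀ f g : ι → ℝ, (∑ i, f i) * (∑ j, g j) = ∑ i, ∑ j, f i * g j := fun f g =>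
      Finset.sum_mul_sum _ _ _ _
    have e2 : (∑ i, l i ^ (a + b) * c i) * ∑ i, c i = ∑ i, ∑ j, c i * (l j ^ (a+b) * c j) := by
      rw [mul_comm, e1]
    have e3 : (∑ i, l i ^ a * c i) * (∑ i, l i ^ b * c i)
       = ∑ i, ∑ j, (l i ^ b * c i) * (l j ^ a * c j) := by
      rw [mul_comm, e1]
    rw [two_mul, two_mul]
    nth_rw 2 [e2]
    nth_rw 2 [e3]
    rw [e1, e1]
    simp only [← Finset.sum_add_distrib, ← Finset.sum_sub_distrib]
    refine Finset.sum_congr rfl fun i _ => Finset.sum_congr rfl fun j _ => ?_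
    ring
  have h3 : 0 ≤ ∑ i, l i ^ (a + b) * c i :=
    Finset.sum_nonneg fun i _ => mul_nonneg (pow_nonneg (hl i) _) (hc i)
  nlinarith

open Matrix in
theorem quad_bound {ι : Type*} [Fintype ι] [DecidableEq ι] (T : Matrix ι ι ℝ) (x : ι → ℝ)
    (h0 : ∀ n, 0 ≤ x ⬝ᵥ (T ^ n *ᵥ x))
    (hm : ∀ a b, (x ⬝ᵥ (T ^ a *ᵥ x)) * (x ⬝ᵥ (T ^ b *ᵥ x)) ≤ x ⬝ᵥ (T ^ (a + b) *ᵥ x))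
    (n : ℕ) : ∀ a, x ⬝ᵥ ((T ^ a * (T + vecMulVec x x) ^ n) *ᵥ x)
      ≤ x ⬝ᵥ ((T ^ a * (1 + T) ^ n) *ᵥ x) := by
  have hm' : ∀ n a b, (x ⬝ᵥ (T ^ a *ᵥ x)) * (x ⬝ᵥ ((T ^ b * (1 + T) ^ n) *ᵥ x)) ≤
      x ⬝ᵥ ((T ^ (a + b) * (1 + T) ^ n) *ᵥ x) := by
    intro n
    induction n with
    | zero => intro a b; simpa using hm a b
    | succ n ih =>
      intro a b
      have e : ∀ c, T ^ c * (1 + T) ^ (n + 1) = T ^ c * (1 + T) ^ n + T ^ (c + 1) * (1 + T) ^ n := by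
        intro c
        rw [pow_succ', ← mul_assoc, mul_add, add_mul, mul_one, pow_succ]
      rw [e, e, add_mulVec, add_mulVec, dotProduct_add, dotProduct_add, mul_add]
      exact add_le_add (ih a b) (by simpa [add_assoc] using ih a (b+1))
  induction n with
  | zero => intro a; simp
  | succ n ih =>
    intro a
    have e : T ^ a * (T + vecMulVec x x) ^ (n + 1) = T ^ (a + 1) * (T + vecMulVec x x) ^ n
        + T ^ a * (vecMulVec x x * (T + vecMulVec x x) ^ n) := by
      rw [pow_succ', ← mul_assoc, mul_add, add_mul, pow_succ, mul_assoc, mul_assoc]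
    have e' : T ^ a * (1 + T) ^ (n + 1) = T ^ (a + 1) * (1 + T) ^ n + T ^ a * (1 + T) ^ n  := by
      rw [pow_succ', ← mul_assoc, mul_add, add_mul, mul_one, pow_succ, add_comm]
    have e2 : x ⬝ᵥ ((T ^ a * (vecMulVec x x * (T + vecMulVec x x) ^ n)) *ᵥ x)
        = (x ⬝ᵥ (T ^ a *ᵥ x)) * (x ⬝ᵥ ((T ^ 0 * (T + vecMulVec x x) ^ n) *ᵥ x)) := by
      rw [← mulVec_mulVec, ← mulVec_mulVec, vecMulVec_mulVec, pow_zero, one_mul]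
      simp [mulVec_smul, dotProduct_smul, mul_comm]
    rw [e, e', add_mulVec, add_mulVec, dotProduct_add, dotProduct_add, e2]
    refine add_le_add (ih (a+1)) ?_
    refine (mul_le_mul_of_nonneg_left (ih 0) (h0 a)).trans ?_
    simpa using hm' n a 0

open Matrix in
theorem trace_bound {ι : Type*} [Fintype ι] [DecidableEq ι] (T : Matrix ι ι ℝ) (x : ι → ℝ)
    (hsym : Tᵀ = T)
    (h0 : ∀ n, 0 ≤ x ⬝ᵥ (T ^ n *ᵥ x))
    (hm : ∀ a b, (x ⬝ᵥ (T ^ a *ᵥ x)) * (x ⬝ᵥ (T ^ b *ᵥ x)) ≤ x ⬝ᵥ (T ^ (a + b) *ᵥ x))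
    (n : ℕ) : ∀ a, (T ^ a * (T + vecMulVec x x) ^ n).trace
      ≤ (T ^ (a + n)).trace + x ⬝ᵥ ((T ^ a * ((1 + T) ^ n - T ^ n)) *ᵥ x) := by
  induction n with
  | zero => intro a; simp
  | succ n ih =>
    intro a
    have e : T ^ a * (T + vecMulVec x x) ^ (n + 1) = T ^ (a + 1) * (T + vecMulVec x x) ^ n
        + T ^ a * (vecMulVec x x * (T + vecMulVec x x) ^ n) := by
      rw [pow_succ', ← mul_assoc, mul_add, add_mul, pow_succ, mul_assoc, mul_assoc]
    have hs : (T + vecMulVec x x)ᵀ = T + vecMulVec x x := by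
      rw [transpose_add, hsym, transpose_vecMulVec]
    have e2 : (T ^ a * (vecMulVec x x * (T + vecMulVec x x) ^ n)).trace
        = x ⬝ᵥ ((T ^ a * (T + vecMulVec x x) ^ n) *ᵥ x) := by
      rw [vecMulVec_mul, mul_vecMulVec, trace_vecMulVec, ← mulVec_mulVec, ← mulVec_transpose,
        transpose_pow, hs, dotProduct_mulVec x, ← mulVec_transpose, transpose_pow, hsym]
    have e3 : T ^ a * ((1 + T) ^ (n + 1) - T ^ (n + 1)) =
       T ^ (a + 1) * ((1 + T) ^ n - T ^ n) + T ^ a * (1 + T) ^ n := by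
      have : (1 + T) ^ (n + 1) - T ^ (n + 1) = T * ((1 + T) ^ n - T ^ n) + (1 + T) ^ n := by
        rw [pow_succ', pow_succ', add_mul, mul_sub, one_mul]; abel
      rw [this, mul_add, pow_succ, mul_assoc]
    rw [e, trace_add, e2, e3, add_mulVec, dotProduct_add]
    have i1 := ih (a + 1)
    have i2 := quad_bound T x h0 hm n a
    have e4 : a + 1 + n = a + (n + 1) := by ring
    rw [e4] at i1
    linarith

/-- truncated exponential -/
def texp (m : ℕ) (t : ℝ) : ℝ := ∑ n ∈ Finset.range (m + 1), t ^ n / n.factorial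

/-- trace of the truncated exponential of a matrix -/
def ttr {ι : Type*} [Fintype ι] [DecidableEq ι] (m : ℕ) (T : Matrix ι ι ℝ) : ℝ :=
  ∑ n ∈ Finset.range (m + 1), (T ^ n).trace / n.factorial

theorem texp_one_add (m : ℕ) (t : ℝ) (ht : 0 ≤ t) : texp m (1 + t) ≤ 3 * texp m t := by
  have h1 : texp m (1 + t) = ∑ n ∈ Finset.range (m + 1), ∑ s ∈ Finset.range (n + 1),
      (t ^ s / s.factorial) * (1 / (n - s).factorial) := by
    unfold texp
    refine Finset.sum_congr rfl fun n _ => ?_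
    rw [add_comm, add_pow, Finset.sum_div]
    refine Finset.sum_congr rfl fun s hs => ?_
    have hs' : s ≤ n := by simpa [Nat.lt_succ_iff] using hs
    rw [Nat.cast_choose ℝ hs']
    have := Nat.factorial_pos n
    field_simp
    simp
  have h2 : ∑ n ∈ Finset.range (m + 1), ∑ s ∈ Finset.range (n + 1),
      (t ^ s / s.factorial) * (1 / ((n - s).factorial : ℝ))
      = ∑ s ∈ Finset.range (m + 1), ∑ r ∈ Finset.range (m + 1 - s),
      (t ^ s / s.factorial) * (1 / (r.factorial : ℝ)) := by
    rw [Finset.sum_sigma', Finset.sum_sigma']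
    refine Finset.sum_bij' (fun x _ => ⟨x.2, x.1 - x.2⟩) (fun x _ => ⟨x.1 + x.2, x.1⟩) ?_ ?_ ?_ ?_ ?_
    · rintro ⟨a, b⟩ h; simp at h ⊢; omega
    · rintro ⟨a, b⟩ h; simp at h ⊢; omega
    · rintro ⟨a, b⟩ h; simp at h ⊢; omega
    · rintro ⟨a, b⟩ h; simp at h ⊢
    · rintro ⟨a, b⟩ h; simp
  rw [h1, h2, texp, Finset.mul_sum]
  refine Finset.sum_le_sum fun s _ => ?_
  rw [← Finset.mul_sum, mul_comm]
  refine mul_le_mul_of_nonneg_right ?_ (by positivity)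
  have := Real.sum_le_exp_of_nonneg (x := 1) zero_le_one (m + 1 - s)
  simp only [one_pow] at this
  exact this.trans Real.exp_one_lt_three.le

theorem texp_nonneg (m : ℕ) (t : ℝ) (ht : 0 ≤ t) : 0 ≤ texp m t :=
  Finset.sum_nonneg fun _ _ => by positivity

open Matrix in
/-- the one-step bound -/
theorem one_step {ι : Type*} [Fintype ι] [DecidableEq ι] (T : Matrix ι ι ℝ) (hT : T.PosSemidef)
    (m : ℕ) :
    ∃ (U : ι → ι → ℝ) (c : ι → ℝ), (∀ i, 0 ≤ c i) ∧ (∀ i, ∑ k, U i k ^ 2 = 1) ∧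
      (∑ i, c i = ttr m T) ∧
      ∀ x : ι → ℝ, ∑ k, x k ^ 2 ≤ 1 →
        ttr m (T + vecMulVec x x) ≤ ttr m T + 2 * ∑ i, c i * (U i ⬝ᵥ x) ^ 2 := by
  obtain ⟨U, l, hl, hU, hq, htr⟩ := spec_data T hT
  refine ⟨U, fun i => texp m (l i), fun i => texp_nonneg m _ (hl i), hU, ?_, ?_⟩
  · simp only [texp, ttr, htr, Finset.sum_div]
    rw [Finset.sum_comm]
  · intro x hx
    have h0 : ∀ n, 0 ≤ x ⬝ᵥ (T ^ n *ᵥ x) := fun n => by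
      rw [hq]; exact Finset.sum_nonneg fun i _ => mul_nonneg (pow_nonneg (hl i) _) (sq_nonneg _)
    have h1 : ∑ i, (U i ⬝ᵥ x) ^ 2 ≤ 1 := by
      have := hq 0 x
      simp only [pow_zero, one_mulVec, one_mul] at this
      rw [← this]; simpa [dotProduct, sq] using hx
    have hm : ∀ a b, (x ⬝ᵥ (T ^ a *ᵥ x)) * (x ⬝ᵥ (T ^ b *ᵥ x)) ≤ x ⬝ᵥ (T ^ (a + b) *ᵥ x) := by
      intro a b
      rw [hq, hq, hq]
      exact cheb l _ hl (fun i => sq_nonneg _) h1 a b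
    have hsym : Tᵀ = T := by
      have := hT.isHermitian.eq
      simpa [conjTranspose_eq_transpose_of_trivial] using this
    have hq1 : ∀ (n a : ℕ), x ⬝ᵥ ((T ^ a * (1 + T) ^ n) *ᵥ x) = ∑ i, l i ^ a * (1 + l i) ^ n * (U i ⬝ᵥ x) ^ 2 := by
      intro n
      induction n with
      | zero => intro a; simpa using hq a x
      | succ n ih =>
        intro a
        have e' : T ^ a * (1 + T) ^ (n + 1) = T ^ (a + 1) * (1 + T) ^ n + T ^ a * (1 + T) ^ n  := by
          rw [pow_succ', ← mul_assoc, mul_add, add_mul, mul_one, pow_succ, add_comm]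
        rw [e', add_mulVec, dotProduct_add, ih, ih, ← Finset.sum_add_distrib]
        refine Finset.sum_congr rfl fun i _ => ?_
        ring
    have hb : ∀ n, ((T + vecMulVec x x) ^ n).trace ≤ (T ^ n).trace +
        ∑ i, ((1 + l i) ^ n - l i ^ n) * (U i ⬝ᵥ x) ^ 2 := by
      intro n
      have := trace_bound T x hsym h0 hm n 0
      simp only [pow_zero, one_mul, zero_add, sub_mulVec, dotProduct_sub] at this
      have h2 := hq1 n 0
      simp only [pow_zero, one_mul] at h2
      rw [h2, hq, ← Finset.sum_sub_distrib] at this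
      refine this.trans (le_of_eq ?_)
      congr 1
      refine Finset.sum_congr rfl fun i _ => ?_
      ring
    have hs : ttr m (T + vecMulVec x x) ≤ ttr m T +
        ∑ i, (texp m (1 + l i) - texp m (l i)) * (U i ⬝ᵥ x) ^ 2 := by
      unfold ttr
      calc _ ≤ ∑ n ∈ Finset.range (m + 1), ((T ^ n).trace +
          ∑ i, ((1 + l i) ^ n - l i ^ n) * (U i ⬝ᵥ x) ^ 2) / n.factorial :=
            Finset.sum_le_sum fun n _ => div_le_div_of_nonneg_right (hb n) (by positivity)
        _ = _ := by
          simp only [add_div, Finset.sum_add_distrib, Finset.sum_div]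
          congr 1
          rw [Finset.sum_comm]
          refine Finset.sum_congr rfl fun i _ => ?_
          rw [texp, texp, ← Finset.sum_sub_distrib, Finset.sum_mul]
          refine Finset.sum_congr rfl fun n _ => ?_
          ring
    refine hs.trans ?_
    rw [Finset.mul_sum]
    refine add_le_add le_rfl (Finset.sum_le_sum fun i _ => ?_)
    have := texp_one_add m (l i) (hl i)
    nlinarith [sq_nonneg (U i ⬝ᵥ x)]

/-- sum of rank one matrices -/
def smat {ι : Type*} [Fintype ι] {p : ℕ} (y : Fin p → ι → ℝ) : Matrix ι ι ℝ :=
  ∑ j, Matrix.vecMulVec (y j) (y j)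

theorem smat_psd {ι : Type*} [Fintype ι] {p : ℕ} (y : Fin p → ι → ℝ) : (smat y).PosSemidef := by
  unfold smat
  refine Matrix.posSemidef_sum _ fun j _ => ?_
  simpa using Matrix.posSemidef_vecMulVec_self_star (y j)

theorem ttr_smat_cont {ι : Type*} [Fintype ι] [DecidableEq ι] (p m : ℕ) :
    Continuous fun y : Fin p → ι → ℝ => ttr m (smat y) := by
  have h : Continuous fun y : Fin p → ι → ℝ => smat y := by
    unfold smat
    refine continuous_finsetSum _ fun j _ => ?_
    refine continuous_matrix fun a b => ?_
    simp only [Matrix.vecMulVec_apply]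
    fun_prop
  unfold ttr
  refine continuous_finsetSum _ fun n _ => ?_
  exact (Continuous.matrix_trace (h.pow n)).div_const _

theorem ttr_nonneg {ι : Type*} [Fintype ι] [DecidableEq ι] (m : ℕ) (T : Matrix ι ι ℝ)
    (hT : T.PosSemidef) : 0 ≤ ttr m T := by
  obtain ⟨U, c, hc, -, hs, -⟩ := one_step T hT m
  rw [← hs]; exact Finset.sum_nonneg fun i _ => hc i

open Matrix in
theorem chernoff_step {ι Ω : Type*} [Fintype ι] [DecidableEq ι] [MeasurableSpace Ω]
    (ν : Measure Ω) [IsProbabilityMeasure ν] (x : Ω → ι → ℝ) (hx : Measurable x)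
    (hb : ∀ᵐ ω ∂ν, ∑ k, x ω k ^ 2 ≤ 1) (lam : ℝ)
    (hcov : ∀ u : ι → ℝ, ∑ k, u k ^ 2 = 1 → ∫ ω, (u ⬝ᵥ x ω) ^ 2 ∂ν ≤ lam)
    (m : ℕ) (T : Matrix ι ι ℝ) (hT : T.PosSemidef) :
    ∫⁻ ω, ENNReal.ofReal (ttr m (T + vecMulVec (x ω) (x ω))) ∂ν
      ≤ ENNReal.ofReal ((1 + 2 * lam) * ttr m T) := by
  obtain ⟨U, c, hc, hU, hs, hstep⟩ := one_step T hT m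
  have hint : ∀ i, Integrable (fun ω => (U i ⬝ᵥ x ω) ^ 2) ν := by
    intro i
    refine Integrable.of_bound (C := 1) ?_ ?_
    · refine Measurable.aestronglyMeasurable ?_
      simp only [dotProduct]
      fun_prop
    · filter_upwards [hb] with ω hω
      rw [Real.norm_of_nonneg (sq_nonneg _)]
      have := Finset.sum_mul_sq_le_sq_mul_sq Finset.univ (U i) (x ω)
      rw [hU, one_mul] at this
      exact this.trans hω
  have hint2 : Integrable (fun ω => ttr m T + 2 * ∑ i, c i * (U i ⬝ᵥ x ω) ^ 2) ν := by
    refine (integrable_const _).add (Integrable.const_mul ?_ _)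
    exact integrable_finsetSum _ fun i _ => (hint i).const_mul _
  calc _ ≤ ∫⁻ ω, ENNReal.ofReal (ttr m T + 2 * ∑ i, c i * (U i ⬝ᵥ x ω) ^ 2) ∂ν := by
        refine lintegral_mono_ae ?_
        filter_upwards [hb] with ω hω
        exact ENNReal.ofReal_le_ofReal (hstep _ hω)
    _ = ENNReal.ofReal (∫ ω, ttr m T + 2 * ∑ i, c i * (U i ⬝ᵥ x ω) ^ 2 ∂ν) := by
        rw [ofReal_integral_eq_lintegral_ofReal hint2]
        refine Filter.Eventually.of_forall fun ω => ?_
        have := ttr_nonneg m T hT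
        have : 0 ≤ ∑ i, c i * (U i ⬝ᵥ x ω) ^ 2 :=
          Finset.sum_nonneg fun i _ => mul_nonneg (hc i) (sq_nonneg _)
        simp only [Pi.zero_apply]
        positivity
    _ ≤ _ := by
        refine ENNReal.ofReal_le_ofReal ?_
        rw [integral_add (integrable_const _)
          ((integrable_finsetSum _ fun i _ => (hint i).const_mul _).const_mul _),
          integral_const_mul, integral_finsetSum _ fun i _ => (hint i).const_mul _]
        simp only [integral_const, probReal_univ, one_smul, integral_const_mul]
        have : ∑ i, c i * ∫ ω, (U i ⬝ᵥ x ω) ^ 2 ∂ν ≤ ∑ i, c i * lam :=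
          Finset.sum_le_sum fun i _ => mul_le_mul_of_nonneg_left (hcov _ (hU i)) (hc i)
        rw [← Finset.sum_mul, hs] at this
        linarith

open Matrix in
theorem chernoff {ι Ω : Type*} [Fintype ι] [DecidableEq ι] [MeasurableSpace Ω]
    (ν : Measure Ω) [IsProbabilityMeasure ν] (x : Ω → ι → ℝ) (hx : Measurable x)
    (hb : ∀ᵐ ω ∂ν, ∑ k, x ω k ^ 2 ≤ 1) (lam : ℝ) (hlam : 0 ≤ lam)
    (hcov : ∀ u : ι → ℝ, ∑ k, u k ^ 2 = 1 → ∫ ω, (u ⬝ᵥ x ω) ^ 2 ∂ν ≤ lam)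
    (m p : ℕ) :
    ∫⁻ w, ENNReal.ofReal (ttr m (smat fun j => x (w j))) ∂(Measure.pi fun _ : Fin p => ν)
      ≤ ENNReal.ofReal ((1 + 2 * lam) ^ p * Fintype.card ι) := by
  induction p with
  | zero =>
    have : ∀ w : Fin 0 → Ω, ttr m (smat fun j => x (w j)) = Fintype.card ι := by
      intro w
      simp only [smat, ttr, Finset.univ_eq_empty, Finset.sum_empty]
      rw [Finset.sum_eq_single 0]
      · simp
      · intro n _ hn; simp [hn]
      · simp
    simp only [this]
    simp
  | succ p ih =>
    have hmeas : ∀ p, Measurable fun w : Fin p → Ω => ttr m (smat fun j => x (w j)) := by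
      intro p
      exact (ttr_smat_cont p m).measurable.comp
        (measurable_pi_lambda _ fun j => hx.comp (measurable_pi_apply j))
    have hmp := measurePreserving_piFinSuccAbove (fun _ : Fin (p + 1) => ν) 0
    have hsplit : ∀ w : Fin (p + 1) → Ω, smat (fun j => x (w j))
        = smat (fun j : Fin p => x (w j.succ)) + vecMulVec (x (w 0)) (x (w 0)) := by
      intro w
      simp only [smat]
      rw [Fin.sum_univ_succ, add_comm]
    have hmeas2 : Measurable fun z : Ω × (Fin p → Ω) =>
        ENNReal.ofReal (ttr m (smat (fun j : Fin p => x (z.2 j)) + vecMulVec (x z.1) (x z.1))) := by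
      have := (hmeas (p + 1)).comp (MeasurableEquiv.piFinSuccAbove (fun _ : Fin (p + 1) => Ω) 0).symm.measurable
      have h2 := this.ennreal_ofReal
      convert h2 using 3 with z
      simp only [Function.comp]
      rw [hsplit]
      simp [MeasurableEquiv.piFinSuccAbove]
    have e1 : ∫⁻ w, ENNReal.ofReal (ttr m (smat fun j => x (w j))) ∂(Measure.pi fun _ : Fin (p+1) => ν)
      = ∫⁻ z, ENNReal.ofReal (ttr m (smat (fun j : Fin p => x (z.2 j)) + vecMulVec (x z.1) (x z.1)))
        ∂(ν.prod (Measure.pi fun _ : Fin p => ν)) := by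
      rw [← hmp.lintegral_comp hmeas2]
      refine lintegral_congr fun w => ?_
      rw [hsplit]
      rfl
    have e2 : ∀ w : Fin p → Ω,
        ∫⁻ a, ENNReal.ofReal (ttr m (smat (fun j : Fin p => x (w j)) + vecMulVec (x a) (x a))) ∂ν
        ≤ ENNReal.ofReal (1 + 2 * lam) * ENNReal.ofReal (ttr m (smat fun j => x (w j))) := by
      intro w
      rw [← ENNReal.ofReal_mul (by positivity)]
      exact chernoff_step ν x hx hb lam hcov m (smat fun j => x (w j)) (smat_psd _)
    have e3 : ENNReal.ofReal (1 + 2 * lam) * ENNReal.ofReal ((1 + 2 * lam) ^ p * Fintype.card ι)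
        = ENNReal.ofReal ((1 + 2 * lam) ^ (p + 1) * Fintype.card ι) := by
      rw [← ENNReal.ofReal_mul (by positivity), pow_succ']
      congr 1
      exact (mul_assoc _ _ _).symm
    rw [e1, lintegral_prod_symm _ hmeas2.aemeasurable, ← e3]
    refine (lintegral_mono e2).trans ?_
    rw [lintegral_const_mul _ (hmeas p).ennreal_ofReal]
    exact mul_le_mul_right ih _

open Matrix in
/-- from the trace to a bound on linear combinations -/
theorem lin_comb_bound {ι : Type*} [Fintype ι] [DecidableEq ι] {p : ℕ} (y : Fin p → ι → ℝ)
    (m : ℕ) (Lam : ℝ) (hL : 0 ≤ Lam)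
    (h : ttr m (smat y) ≤ Lam ^ m / m.factorial) (hm : m ≠ 0) (θ : Fin p → ℝ) :
    ∑ k, (∑ j, θ j * y j k) ^ 2 ≤ Lam * ∑ j, θ j ^ 2 := by
  obtain ⟨U, l, hl, hU, hq, htr⟩ := spec_data (smat y) (smat_psd y)
  have hle : ∀ i, l i ≤ Lam := by
    intro i
    have h1 : ttr m (smat y) = ∑ i, texp m (l i) := by
      simp only [texp, ttr, htr, Finset.sum_div]
      rw [Finset.sum_comm]
    have h2 : texp m (l i) ≤ ttr m (smat y) := by
      rw [h1]
      exact Finset.single_le_sum (f := fun i => texp m (l i)) (fun i _ => texp_nonneg m _ (hl i)) (Finset.mem_univ i)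
    have h3 : l i ^ m / m.factorial ≤ texp m (l i) := by
      refine Finset.single_le_sum (f := fun n : ℕ => l i ^ n / n.factorial) (fun n _ => ?_) (by simp)
      have := hl i
      positivity
    have h4 : l i ^ m ≤ Lam ^ m := by
      have h5 := (h3.trans h2).trans h
      have : (0:ℝ) < m.factorial := by positivity
      exact (div_le_div_iff_of_pos_right this).1 h5
    exact (pow_le_pow_iff_left₀ (hl i) hL hm).1 h4
  set z : ι → ℝ := fun k => ∑ j, θ j * y j k with hz
  have hz2 : z ⬝ᵥ (smat y *ᵥ z) = ∑ j, (y j ⬝ᵥ z) ^ 2 := by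
    simp only [smat, sum_mulVec, dotProduct_sum, vecMulVec_mulVec]
    refine Finset.sum_congr rfl fun j _ => ?_
    simp [dotProduct_smul, sq, dotProduct_comm z (y j)]
  have hz3 : z ⬝ᵥ (smat y *ᵥ z) ≤ Lam * ∑ k, z k ^ 2 := by
    have a1 := hq 1 z
    have a0 := hq 0 z
    simp only [pow_zero, one_mulVec, one_mul, pow_one] at a0 a1
    have : z ⬝ᵥ z = ∑ k, z k ^ 2 := by simp [dotProduct, sq]
    rw [a1, ← this, a0, Finset.mul_sum]
    exact Finset.sum_le_sum fun i _ => mul_le_mul_of_nonneg_right (hle i) (sq_nonneg _)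
  have hz4 : ∑ k, z k ^ 2 = ∑ j, θ j * (y j ⬝ᵥ z) := by
    simp only [dotProduct, Finset.mul_sum]
    rw [Finset.sum_comm]
    refine Finset.sum_congr rfl fun k _ => ?_
    rw [sq]; nth_rw 1 [hz]
    simp only [Finset.sum_mul, mul_assoc]
  have hz5 := Finset.sum_mul_sq_le_sq_mul_sq Finset.univ θ (fun j => y j ⬝ᵥ z)
  rw [← hz4, ← hz2] at hz5
  have hN : 0 ≤ ∑ k, z k ^ 2 := Finset.sum_nonneg fun _ _ => sq_nonneg _
  have hθ : 0 ≤ ∑ j, θ j ^ 2 := Finset.sum_nonneg fun _ _ => sq_nonneg _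
  change ∑ k, z k ^ 2 ≤ _
  rcases hN.eq_or_lt with h0 | h0
  · rw [← h0]; positivity
  · refine le_of_mul_le_mul_right ?_ h0
    calc _ = (∑ k, z k ^ 2) ^ 2 := by ring
      _ ≤ _ := hz5
      _ ≤ (∑ j, θ j ^ 2) * (Lam * ∑ k, z k ^ 2) := mul_le_mul_of_nonneg_left hz3 hθ
      _ = _ := by ring

theorem qvec_inner (d k : ℕ) (w v : Fin d → ℝ) :
    ∑ κ : MIdx d k, qvec d k w κ * qvec d k v κ = (∑ i, w i * v i) ^ k := by
  rw [Finset.sum_pow_eq_sum_piAntidiag]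
  have h1 : Finset.piAntidiag (Finset.univ : Finset (Fin d)) k = Finset.Nat.antidiagonalTuple d k := by
    ext f; simp [Finset.mem_piAntidiag, Finset.Nat.mem_antidiagonalTuple]
  rw [h1, ← Finset.sum_coe_sort (Finset.Nat.antidiagonalTuple d k)]
  refine Finset.sum_congr rfl fun κ _ => ?_
  have hκ : ∑ i, κ.1 i = k := Finset.Nat.mem_antidiagonalTuple.1 κ.2
  have h2 : (Nat.factorial k : ℝ) / ∏ i, (Nat.factorial (κ.1 i) : ℝ)
      = (Nat.multinomial Finset.univ κ.1 : ℝ) := by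
    rw [Nat.multinomial, hκ, Nat.cast_div]
    · push_cast; rfl
    · have := Nat.prod_factorial_dvd_factorial_sum Finset.univ κ.1
      rwa [hκ] at this
    · have : ∏ i, Nat.factorial (κ.1 i) ≠ 0 := Finset.prod_ne_zero_iff.2 fun i _ => Nat.factorial_ne_zero _
      exact_mod_cast this
  simp only [qvec, h2]
  have h3 := Real.mul_self_sqrt (Nat.cast_nonneg (α := ℝ) (Nat.multinomial Finset.univ κ.1))
  simp only [mul_pow, Finset.prod_mul_distrib]
  calc _ = (√(Nat.multinomial Finset.univ κ.1 : ℝ) * √(Nat.multinomial Finset.univ κ.1 : ℝ)) *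
      ((∏ i, w i ^ κ.1 i) * ∏ i, v i ^ κ.1 i) := by ring
    _ = _ := by rw [h3]

/-- the kernel quadratic form -/
def kq {d p : ℕ} (w : Fin p → Fin d → ℝ) (k : ℕ) (θ : Fin p → ℝ) : ℝ :=
  ∑ j, ∑ l, θ j * θ l * (∑ i, w j i * w l i) ^ k

theorem sum_sq_comb {ι : Type*} [Fintype ι] {p : ℕ} (θ : Fin p → ℝ) (y : Fin p → ι → ℝ) :
    ∑ k, (∑ j, θ j * y j k) ^ 2 = ∑ j, ∑ l, θ j * θ l * ∑ k, y j k * y l k := by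
  simp only [sq, Finset.sum_mul_sum]
  simp only [Finset.mul_sum]
  rw [Finset.sum_comm]
  refine Finset.sum_congr rfl fun j _ => ?_
  rw [Finset.sum_comm]
  refine Finset.sum_congr rfl fun l _ => Finset.sum_congr rfl fun k _ => ?_
  ring

theorem kq_eq {d p : ℕ} (w : Fin p → Fin d → ℝ) (k : ℕ) (θ : Fin p → ℝ) :
    ∑ κ : MIdx d k, (∑ j, θ j * qvec d k (w j) κ) ^ 2 = kq w k θ := by
  rw [sum_sq_comb]
  simp only [qvec_inner]; rfl

/-- centered second-order feature -/
def feat (d : ℕ) (w : Fin d → ℝ) : Fin d × Fin d → ℝ :=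
  fun z => w z.1 * w z.2 - if z.1 = z.2 then 1 / (d : ℝ) else 0

theorem feat_inner (d : ℕ) (hd : d ≠ 0) (w v : Fin d → ℝ) (hw : ∑ i, w i ^ 2 = 1)
    (hv : ∑ i, v i ^ 2 = 1) :
    ∑ z, feat d w z * feat d v z = (∑ i, w i * v i) ^ 2 - 1 / d := by
  have hd' : (d : ℝ) ≠ 0 := by exact_mod_cast hd
  rw [Fintype.sum_prod_type]
  have : ∀ i, ∑ j, feat d w (i, j) * feat d v (i, j)
      = (w i * v i) * (∑ j, w j * v j) - 1 / d * w i ^ 2 - 1 / d * v i ^ 2 + 1 / d * (1 / d) := by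
    intro i
    simp only [feat, sub_mul, mul_sub, Finset.sum_sub_distrib, ite_mul, mul_ite, mul_zero, zero_mul,
      Finset.sum_ite_eq, Finset.mem_univ, if_true, Finset.mul_sum]
    have : ∀ j, w i * w j * (v i * v j) = w i * v i * (w j * v j) := fun j => by ring
    simp only [this]
    ring
  simp only [this, Finset.sum_add_distrib, Finset.sum_sub_distrib, ← Finset.mul_sum, ← Finset.sum_mul, hw, hv]
  simp
  field_simp
  ring

theorem kq_step {d p : ℕ} (hd : d ≠ 0) (w : Fin p → Fin d → ℝ) (hw : ∀ j, ∑ i, w j i ^ 2 = 1)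
    (Lam : ℝ)
    (hL : ∀ θ : Fin p → ℝ, ∑ z, (∑ j, θ j * feat d (w j) z) ^ 2 ≤ Lam * ∑ j, θ j ^ 2)
    (k : ℕ) (θ : Fin p → ℝ) :
    kq w (k + 2) θ ≤ Lam * ∑ j, θ j ^ 2 + 1 / d * kq w k θ := by
  have h1 : ∑ κ : MIdx d k, ∑ z, (∑ j, (θ j * qvec d k (w j) κ) * feat d (w j) z) ^ 2
      ≤ ∑ κ : MIdx d k, Lam * ∑ j, (θ j * qvec d k (w j) κ) ^ 2 :=
    Finset.sum_le_sum fun κ _ => hL _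
  have h2 : ∑ κ : MIdx d k, Lam * ∑ j, (θ j * qvec d k (w j) κ) ^ 2 = Lam * ∑ j, θ j ^ 2 := by
    rw [← Finset.mul_sum, Finset.sum_comm]
    congr 1
    refine Finset.sum_congr rfl fun j _ => ?_
    have h := qvec_inner d k (w j) (w j)
    simp only [← sq, hw, one_pow] at h
    simp only [mul_pow, ← Finset.mul_sum, h, mul_one]
  have h3 : ∑ κ : MIdx d k, ∑ z, (∑ j, (θ j * qvec d k (w j) κ) * feat d (w j) z) ^ 2
      = kq w (k + 2) θ - 1 / d * kq w k θ := by
    simp only [sum_sq_comb, feat_inner d hd _ _ (hw _) (hw _)]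
    rw [Finset.sum_comm]
    simp only [kq, Finset.mul_sum, ← Finset.sum_sub_distrib]
    refine Finset.sum_congr rfl fun j _ => ?_
    rw [Finset.sum_comm]
    refine Finset.sum_congr rfl fun l _ => ?_
    have : ∀ κ : MIdx d k, θ j * qvec d k (w j) κ * (θ l * qvec d k (w l) κ) * ((∑ i, w j i * w l i) ^ 2 - 1 / d)
       = (qvec d k (w j) κ * qvec d k (w l) κ) * (θ j * θ l * ((∑ i, w j i * w l i) ^ 2 - 1 / d)) := fun κ => by ring
    simp only [this]
    rw [← Finset.sum_mul, qvec_inner]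
    ring
  rw [h2, h3] at h1
  linarith

theorem enorm2_meas {ι : Type*} [Fintype ι] : Measurable (fun x : ι → ℝ => (enorm2 x)⁻¹ • x) := by
  unfold enorm2
  fun_prop

instance unifSphere_prob (ι : Type*) [Fintype ι] : IsProbabilityMeasure (unifSphere ι) := by
  unfold unifSphere
  have : IsProbabilityMeasure (stdG ι) := by unfold stdG; infer_instance
  exact Measure.isProbabilityMeasure_map enorm2_meas.aemeasurable

theorem sphere_ae (d : ℕ) (hd : d ≠ 0) : ∀ᵐ w ∂(unifSphere (Fin d)), ∑ i, w i ^ 2 = 1 := by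
  unfold unifSphere
  rw [ae_map_iff enorm2_meas.aemeasurable (measurableSet_eq_fun (by fun_prop) measurable_const)]
  let i0 : Fin d := ⟨0, Nat.pos_of_ne_zero hd⟩
  have h : ∀ᵐ x ∂(stdG (Fin d)), x i0 ≠ 0 := by
    unfold stdG
    have h0 : ∀ᵐ t ∂(gaussianReal 0 1), t ≠ 0 := by
      have := nullSingletonClass_gaussianReal (μ := 0) (v := 1) one_ne_zero
      exact compl_mem_ae_iff.2 (measure_singleton 0)
    exact (measurePreserving_eval (fun _ : Fin d => gaussianReal 0 1) i0).quasiMeasurePreserving.ae h0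
  filter_upwards [h] with x hx
  have hpos : 0 < ∑ i, x i ^ 2 := by
    refine lt_of_lt_of_le (by positivity : 0 < x i0 ^ 2) ?_
    exact Finset.single_le_sum (f := fun i => x i ^ 2) (fun i _ => sq_nonneg _) (Finset.mem_univ i0)
  simp only [Pi.smul_apply, smul_eq_mul, mul_pow, ← Finset.mul_sum, enorm2]
  rw [inv_pow, Real.sq_sqrt hpos.le]
  exact inv_mul_cancel₀ hpos.ne'

theorem sphere_int (d : ℕ) (hd : d ≠ 0) (f : (Fin d → ℝ) → ℝ) (hf : Continuous f) :
    Integrable f (unifSphere (Fin d)) := by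
  obtain ⟨C, hC⟩ := (isCompact_closedBall (0 : Fin d → ℝ) 1).exists_bound_of_continuousOn hf.continuousOn
  refine Integrable.of_bound (C := C) hf.aestronglyMeasurable ?_
  filter_upwards [sphere_ae d hd] with w hw
  refine hC w ?_
  rw [mem_closedBall_zero_iff, pi_norm_le_iff_of_nonneg zero_le_one]
  intro i
  rw [Real.norm_eq_abs, ← sq_le_one_iff_abs_le_one, ← hw]
  exact Finset.single_le_sum (f := fun i => w i ^ 2) (fun i _ => sq_nonneg _) (Finset.mem_univ i)

theorem sphere_rot (d : ℕ) (u v : Fin d → ℝ) (huv : ∑ i, u i ^ 2 = ∑ i, v i ^ 2) (n : ℕ) :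
    ∫ w, (∑ i, u i * w i) ^ n ∂(unifSphere (Fin d)) = ∫ w, (∑ i, v i * w i) ^ n ∂(unifSphere (Fin d)) := by
  have key : ∀ u : Fin d → ℝ, ∫ w, (∑ i, u i * w i) ^ n ∂(unifSphere (Fin d))
      = ∫ x, (‖x‖⁻¹ * inner ℝ (WithLp.toLp 2 u) x) ^ n ∂(stdGaussian (EuclideanSpace ℝ (Fin d))) := by
    intro u
    rw [← map_pi_eq_stdGaussian, unifSphere, integral_map enorm2_meas.aemeasurable
      (Continuous.aestronglyMeasurable (by fun_prop)), integral_map (by fun_prop)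
      (Measurable.aestronglyMeasurable (by fun_prop))]
    refine integral_congr_ae (Filter.Eventually.of_forall fun x => ?_)
    simp only [enorm2, EuclideanSpace.norm_eq, PiLp.inner_apply, Real.norm_eq_abs, sq_abs,
      Pi.smul_apply, smul_eq_mul, Finset.mul_sum]
    congr 1
    refine Finset.sum_congr rfl fun i _ => ?_
    simp
    ring
  have hn : ‖(WithLp.toLp 2 u : EuclideanSpace ℝ (Fin d))‖ = ‖(WithLp.toLp 2 v : EuclideanSpace ℝ (Fin d))‖ := by
    simp [EuclideanSpace.norm_eq, huv]
  obtain ⟨R, hR⟩ : ∃ R : EuclideanSpace ℝ (Fin d) ≃ₗᵢ[ℝ] EuclideanSpace ℝ (Fin d),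
      R (WithLp.toLp 2 v) = WithLp.toLp 2 u := ⟨_, Submodule.reflection_sub hn.symm⟩
  rw [key, key, ← stdGaussian_map R]
  rw [integral_map (by fun_prop) (Measurable.aestronglyMeasurable (by fun_prop))]
  rw [stdGaussian_map R]
  refine integral_congr_ae (Filter.Eventually.of_forall fun x => ?_)
  simp only
  rw [← hR, R.inner_map_map, R.norm_map]

theorem sphere_mom (d : ℕ) (hd : d ≠ 0) (n : ℕ) : ∃ a : ℝ, ∀ u : Fin d → ℝ,
    ∫ w, (∑ i, u i * w i) ^ (2 * n) ∂(unifSphere (Fin d)) = a * (∑ i, u i ^ 2) ^ n := by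
  let i0 : Fin d := ⟨0, Nat.pos_of_ne_zero hd⟩
  refine ⟨∫ w, w i0 ^ (2 * n) ∂(unifSphere (Fin d)), fun u => ?_⟩
  have hnn : 0 ≤ ∑ i, u i ^ 2 := Finset.sum_nonneg fun i _ => sq_nonneg _
  rw [sphere_rot d u (Pi.single i0 (√(∑ i, u i ^ 2)))]
  · simp only [Pi.single_apply, ite_mul, zero_mul, Finset.sum_ite_eq', Finset.mem_univ, if_true, mul_pow]
    rw [integral_const_mul, pow_mul, Real.sq_sqrt hnn, mul_comm]
  · simp [Pi.single_apply, ite_pow, Real.sq_sqrt hnn]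

theorem sphere_mom2 (d : ℕ) (hd : d ≠ 0) (i j : Fin d) :
    ∫ w, w i * w j ∂(unifSphere (Fin d)) = (1 / d) * if i = j then 1 else 0 := by
  obtain ⟨a, ha⟩ := sphere_mom d hd 1
  simp only [mul_one, pow_one] at ha
  have hg : ∀ i j, ∫ w, w i * w j ∂(unifSphere (Fin d)) = a * if i = j then 1 else 0 := by
    intro i j
    have e : ∀ w : Fin d → ℝ, w i * w j = 1 / 4 * (∑ r, (Pi.single i 1 + Pi.single j 1 : Fin d → ℝ) r * w r) ^ 2
        - 1 / 4 * (∑ r, (Pi.single i 1 - Pi.single j 1 : Fin d → ℝ) r * w r) ^ 2 := by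
      intro w
      simp only [Pi.add_apply, Pi.sub_apply, Pi.single_apply, add_mul, sub_mul, ite_mul, zero_mul, one_mul,
        Finset.sum_add_distrib, Finset.sum_sub_distrib, Finset.sum_ite_eq', Finset.mem_univ, if_true]
      ring
    simp only [e]
    rw [integral_sub (sphere_int d hd _ (by fun_prop)) (sphere_int d hd _ (by fun_prop)),
      integral_const_mul, integral_const_mul, ha, ha, ← mul_assoc, ← mul_assoc, mul_comm (1/4) a,
      mul_assoc, mul_assoc, ← mul_sub]
    congr 1
    have e3 : ∀ r, (Pi.single i 1 + Pi.single j 1 : Fin d → ℝ) r ^ 2 - (Pi.single i 1 - Pi.single j 1 : Fin d → ℝ) r ^ 2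
       = if r = i then (if r = j then 4 else 0) else 0 := by
      intro r
      simp only [Pi.add_apply, Pi.sub_apply, Pi.single_apply]
      split_ifs <;> norm_num
    rw [← mul_sub, ← Finset.sum_sub_distrib]
    simp only [e3]
    simp
  have h1 : ∫ w, ∑ i, w i * w i ∂(unifSphere (Fin d)) = 1 := by
    have : (fun w : Fin d → ℝ => ∑ i, w i * w i) =ᵐ[unifSphere (Fin d)] fun _ => 1 := by
      filter_upwards [sphere_ae d hd] with w hw
      simpa [sq] using hw
    rw [integral_congr_ae this]; simp
  rw [integral_finsetSum _ fun i _ => sphere_int d hd _ (by fun_prop)] at h1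
  simp only [hg, if_true] at h1
  simp at h1
  rw [hg]
  congr 1
  have hd' : (d : ℝ) ≠ 0 := by exact_mod_cast hd
  field_simp
  linarith

/-- Kronecker delta -/
def dl {d : ℕ} (i j : Fin d) : ℝ := if i = j then 1 else 0

theorem sphere_mom4 (d : ℕ) (hd : d ≠ 0) (i j k l : Fin d) :
    ∫ w, w i * w j * (w k * w l) ∂(unifSphere (Fin d)) = (1 / (d * (d + 2))) *
      (dl i j * dl k l + dl i k * dl j l + dl i l * dl j k) := by
  obtain ⟨a, ha⟩ := sphere_mom d hd 2
  have hg : ∀ i j k l, ∫ w, w i * w j * (w k * w l) ∂(unifSphere (Fin d)) = a / 3 *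
      (dl i j * dl k l + dl i k * dl j l + dl i l * dl j k) := by
    intro i j k l
    let f : ℝ → ℝ → ℝ → Fin d → ℝ := fun x y z r => dl r i + x * dl r j + y * dl r k + z * dl r l
    have hf : ∀ x y z (w : Fin d → ℝ), ∑ r, f x y z r * w r = w i + x * w j + y * w k + z * w l := by
      intro x y z w
      simp [f, dl, add_mul, Finset.sum_add_distrib]
    have hdd : ∀ a b : Fin d, ∑ r, dl r a * dl r b = dl a b := by
      intro a b; simp [dl, eq_comm]
    have hds : ∀ a : Fin d, ∑ r, dl r a ^ 2 = 1 := by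
      intro a; simp [dl]
    have hf2 : ∀ x y z, ∑ r, f x y z r ^ 2 = 1 + x ^ 2 + y ^ 2 + z ^ 2 + 2 * (x * dl i j + y * dl i k + z * dl i l
        + x * y * dl j k + x * z * dl j l + y * z * dl k l) := by
      intro x y z
      have : ∀ r, f x y z r ^ 2 = dl r i ^ 2 + x ^ 2 * dl r j ^ 2 + y ^ 2 * dl r k ^ 2 + z ^ 2 * dl r l ^ 2
        + 2 * (x * (dl r i * dl r j) + y * (dl r i * dl r k) + z * (dl r i * dl r l)
        + x * y * (dl r j * dl r k) + x * z * (dl r j * dl r l) + y * z * (dl r k * dl r l)) := by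
        intro r; simp only [f]; ring
      simp only [this, Finset.sum_add_distrib, ← Finset.mul_sum, hdd, hds]
      ring
    have hI : ∀ x y z, ∫ w, (w i + x * w j + y * w k + z * w l) ^ 4 ∂(unifSphere (Fin d))
        = a * (1 + x ^ 2 + y ^ 2 + z ^ 2 + 2 * (x * dl i j + y * dl i k + z * dl i l
        + x * y * dl j k + x * z * dl j l + y * z * dl k l)) ^ 2 := by
      intro x y z
      rw [← hf2, ← ha]
      simp only [hf]
    let E : Fin 8 → ℝ × ℝ × ℝ := ![(1,1,1),(1,1,-1),(1,-1,1),(1,-1,-1),(-1,1,1),(-1,1,-1),(-1,-1,1),(-1,-1,-1)]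
    have e : ∀ w : Fin d → ℝ, w i * w j * (w k * w l) = ∑ s : Fin 8,
       ((E s).1 * (E s).2.1 * (E s).2.2 / 192) * (w i + (E s).1 * w j + (E s).2.1 * w k + (E s).2.2 * w l) ^ 4 := by
      intro w
      simp only [Fin.sum_univ_eight, E]
      simp
      ring
    simp only [e]
    rw [integral_finsetSum _ fun i _ => sphere_int d hd _ (by fun_prop)]
    simp only [integral_const_mul, hI]
    simp only [Fin.sum_univ_eight, E]
    simp
    ring
  have h1 : ∫ w, ∑ i, ∑ k, w i * w i * (w k * w k) ∂(unifSphere (Fin d)) = 1 := by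
    have : (fun w : Fin d → ℝ => ∑ i, ∑ k, w i * w i * (w k * w k)) =ᵐ[unifSphere (Fin d)] fun _ => 1 := by
      filter_upwards [sphere_ae d hd] with w hw
      rw [← Finset.sum_mul_sum]
      simp only [← sq, hw]
      norm_num
    rw [integral_congr_ae this]; simp
  rw [integral_finsetSum _ fun i _ => sphere_int d hd _ (by fun_prop)] at h1
  have h2 : ∀ i : Fin d, ∫ w, ∑ k, w i * w i * (w k * w k) ∂(unifSphere (Fin d)) = a / 3 * (d + 2) := by
    intro i
    rw [integral_finsetSum _ fun i _ => sphere_int d hd _ (by fun_prop)]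
    simp only [hg, ← Finset.mul_sum]
    congr 1
    simp [dl, Finset.sum_add_distrib]
    ring
  simp only [h2] at h1
  simp at h1
  rw [hg]
  congr 1
  have hd' : (d : ℝ) ≠ 0 := by exact_mod_cast hd
  have hd2 : (d : ℝ) + 2 ≠ 0 := by positivity
  field_simp
  linarith

open Matrix in
theorem feat_cov (d : ℕ) (hd : d ≠ 0) (u : Fin d × Fin d → ℝ) (hu : ∑ z, u z ^ 2 = 1) :
    ∫ w, (u ⬝ᵥ feat d w) ^ 2 ∂(unifSphere (Fin d)) ≤ 2 / (d : ℝ) ^ 2 := by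
  have hd' : (0 : ℝ) < d := by exact_mod_cast Nat.pos_of_ne_zero hd
  set t : ℝ := ∑ i, u (i, i) with ht
  have e1 : ∀ w, u ⬝ᵥ feat d w = (∑ z, u z * (w z.1 * w z.2)) - t / d := by
    intro w
    simp only [dotProduct, feat, mul_sub, Finset.sum_sub_distrib, mul_ite, mul_zero]
    congr 1
    rw [Fintype.sum_prod_type]
    simp [ht, Finset.sum_div, div_eq_mul_inv]
    rw [Finset.sum_mul]
  have e2 : ∀ w, (u ⬝ᵥ feat d w) ^ 2 = (∑ z, ∑ z', u z * u z' * (w z.1 * w z.2 * (w z'.1 * w z'.2)))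
      - (2 * t / d) * (∑ z, u z * (w z.1 * w z.2)) + (t / d) ^ 2 := by
    intro w
    rw [e1]
    have : ∑ z, ∑ z', u z * u z' * (w z.1 * w z.2 * (w z'.1 * w z'.2)) = (∑ z, u z * (w z.1 * w z.2)) ^ 2 := by
      rw [sq, Finset.sum_mul_sum]
      refine Finset.sum_congr rfl fun i _ => Finset.sum_congr rfl fun j _ => ?_
      ring
    rw [this]; ring
  simp only [e2]
  rw [integral_add (sphere_int d hd _ (by fun_prop)) (sphere_int d hd _ (by fun_prop)),
    integral_sub (sphere_int d hd _ (by fun_prop)) (sphere_int d hd _ (by fun_prop)), integral_const_mul,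
    integral_finsetSum _ fun i _ => sphere_int d hd _ (by fun_prop),
    integral_finsetSum _ fun i _ => sphere_int d hd _ (by fun_prop)]
  have h3 : ∑ z : Fin d × Fin d, ∫ w, u z * (w z.1 * w z.2) ∂(unifSphere (Fin d)) = t / d := by
    simp only [integral_const_mul, sphere_mom2 d hd]
    rw [Fintype.sum_prod_type]
    simp [ht, Finset.sum_div, div_eq_mul_inv]
    rw [Finset.sum_mul]
  have h4 : ∀ z : Fin d × Fin d, ∫ w, ∑ z' : Fin d × Fin d, u z * u z' * (w z.1 * w z.2 * (w z'.1 * w z'.2)) ∂(unifSphere (Fin d))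
     = (1 / (d * (d + 2))) * (u z * dl z.1 z.2 * t + u z * u z + u z * u (z.2, z.1)) := by
    intro z
    rw [integral_finsetSum _ fun i _ => sphere_int d hd _ (by fun_prop)]
    simp only [integral_const_mul, sphere_mom4 d hd]
    rw [Fintype.sum_prod_type]
    have : ∀ a b, u z * u (a, b) * (1 / ((d:ℝ) * (d + 2)) * (dl z.1 z.2 * dl a b + dl z.1 a * dl z.2 b + dl z.1 b * dl z.2 a))
      = 1 / ((d:ℝ) * (d + 2)) * (u z * dl z.1 z.2 * (u (a,b) * dl a b) + u z * (u (a, b) * (dl z.1 a * dl z.2 b))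
         + u z * (u (a, b) * (dl z.1 b * dl z.2 a))) := by
      intro a b; ring
    simp only [this, ← Finset.mul_sum, Finset.sum_add_distrib]
    congr 1
    simp [dl, ht]
  simp only [h3, h4, ← Finset.mul_sum, Finset.sum_add_distrib, ← Finset.sum_mul]
  have h5 : ∑ z : Fin d × Fin d, u z * dl z.1 z.2 = t := by
    rw [Fintype.sum_prod_type]; simp [dl, ht]
  have h6 : ∑ z : Fin d × Fin d, u z * u z = 1 := by simpa [sq] using hu
  have h7 : ∑ z : Fin d × Fin d, u (z.2, z.1) ^ 2 = 1 := by
    rw [← hu]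
    exact Equiv.sum_comp (Equiv.prodComm (Fin d) (Fin d)) (fun z => u z ^ 2)
  have h8 : ∑ z : Fin d × Fin d, u z * u (z.2, z.1) ≤ 1 := by
    have : ∑ z : Fin d × Fin d, u z * u (z.2, z.1) ≤ ∑ z : Fin d × Fin d, (u z ^ 2 / 2 + u (z.2, z.1) ^ 2 / 2) :=
      Finset.sum_le_sum fun z _ => by nlinarith [sq_nonneg (u z - u (z.2, z.1))]
    rw [Finset.sum_add_distrib, ← Finset.sum_div, ← Finset.sum_div, hu, h7] at this
    linarith
  rw [h5, h6]
  simp only [integral_const, probReal_univ, one_smul]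
  have h9 : 1 / ((d : ℝ) * (d + 2)) ≤ 1 / (d : ℝ) ^ 2 := by
    apply one_div_le_one_div_of_le <;> nlinarith
  have h10 : 0 ≤ 1 / ((d : ℝ) * (d + 2)) := by positivity
  have h11 : 1 / ((d : ℝ) * (d + 2)) * (t * t + 1 + ∑ z : Fin d × Fin d, u z * u (z.2, z.1))
      ≤ 1 / (d : ℝ) ^ 2 * (t * t + 2) := by
    refine mul_le_mul h9 (by linarith) ?_ (by positivity)
    have : -1 ≤ ∑ z : Fin d × Fin d, u z * u (z.2, z.1) := by
      have : ∑ z : Fin d × Fin d, -(u z ^ 2 / 2 + u (z.2, z.1) ^ 2 / 2) ≤ ∑ z : Fin d × Fin d, u z * u (z.2, z.1) :=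
        Finset.sum_le_sum fun z _ => by nlinarith [sq_nonneg (u z + u (z.2, z.1))]
      rw [Finset.sum_neg_distrib, Finset.sum_add_distrib, ← Finset.sum_div, ← Finset.sum_div, hu, h7] at this
      linarith
    nlinarith [mul_self_nonneg t]
  refine (add_le_add (sub_le_sub h11 le_rfl) le_rfl).trans (le_of_eq ?_)
  field_simp
  ring

theorem feat_meas (d : ℕ) : Measurable (feat d) := by
  unfold feat
  refine measurable_pi_lambda _ fun z => ?_
  fun_prop

theorem feat_norm (d : ℕ) (hd : d ≠ 0) (w : Fin d → ℝ) (hw : ∑ i, w i ^ 2 = 1) :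
    ∑ z, feat d w z ^ 2 ≤ 1 := by
  have h := feat_inner d hd w w hw hw
  simp only [← sq, hw] at h
  rw [h]
  have : (0 : ℝ) ≤ 1 / d := by positivity
  linarith

/-- the high-probability event -/
theorem prob_event (C0 C : ℝ) (hC0 : 0 < C0) (hC : 0 < C) (d p : ℕ) (hd : Real.exp (4 * C0) ≤ d)
    (hlog : 1 ≤ Real.log d) (hp : (p : ℝ) ≤ C0 * (d : ℝ) ^ 2) :
    (Measure.pi fun _ : Fin p => unifSphere (Fin d))
      {w | ¬ ((∀ j, ∑ i, w j i ^ 2 = 1) ∧ ∀ θ : Fin p → ℝ, ∑ z, (∑ j, θ j * feat d (w j) z) ^ 2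
        ≤ (2 * Real.exp (C + 3) * Real.log d) * ∑ j, θ j ^ 2)} ≤ ENNReal.ofReal ((d : ℝ) ^ (-C)) := by
  have hdpos : (0 : ℝ) < d := (Real.exp_pos _).trans_le hd
  have hd0 : d ≠ 0 := by
    rintro rfl; simp at hdpos
  set L := Real.log d with hL
  set m := ⌈L⌉₊ with hm
  have hmL : L ≤ m := Nat.le_ceil L
  have hmL2 : (m : ℝ) ≤ 2 * L := by
    have := Nat.ceil_lt_add_one (a := L) (by linarith)
    linarith
  have hmpos : (0 : ℝ) < m := by linarith
  have hm0 : m ≠ 0 := by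
    intro h; rw [h] at hmpos; simp at hmpos
  set Lam := 2 * Real.exp (C + 3) * L with hLam
  have hLpos : 0 < Lam := by positivity
  have hae : ∀ᵐ w ∂(Measure.pi fun _ : Fin p => unifSphere (Fin d)), ∀ j, ∑ i, w j i ^ 2 = 1 := by
    rw [ae_all_iff]
    intro j
    exact (measurePreserving_eval (fun _ : Fin p => unifSphere (Fin d)) j).quasiMeasurePreserving.ae
      (sphere_ae d hd0)
  have hch := chernoff (unifSphere (Fin d)) (feat d) (feat_meas d)
    ((sphere_ae d hd0).mono fun w hw => feat_norm d hd0 w hw) (2 / (d : ℝ) ^ 2) (by positivity)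
    (feat_cov d hd0) m p
  have hsub : {w : Fin p → Fin d → ℝ | ¬ ((∀ j, ∑ i, w j i ^ 2 = 1) ∧ ∀ θ : Fin p → ℝ, ∑ z, (∑ j, θ j * feat d (w j) z) ^ 2
        ≤ Lam * ∑ j, θ j ^ 2)} ⊆ {w | ¬ ∀ j, ∑ i, w j i ^ 2 = 1} ∪
        {w | ENNReal.ofReal (Lam ^ m / m.factorial) ≤ ENNReal.ofReal (ttr m (smat fun j => feat d (w j)))} := by
    intro w hw
    by_contra hcon
    simp only [Set.mem_union, Set.mem_setOf_eq, not_or, not_not, not_le] at hcon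
    obtain ⟨h1, h2⟩ := hcon
    refine hw ⟨h1, fun θ => ?_⟩
    have h3 : ttr m (smat fun j => feat d (w j)) ≤ Lam ^ m / m.factorial :=
      ((ENNReal.ofReal_lt_ofReal_iff (by positivity)).1 h2).le
    exact lin_comb_bound _ m Lam hLpos.le h3 hm0 θ
  refine (measure_mono hsub).trans ((measure_union_le _ _).trans ?_)
  rw [show (Measure.pi fun _ : Fin p => unifSphere (Fin d)) {w | ¬ ∀ j, ∑ i, w j i ^ 2 = 1} = 0 from hae, zero_add]
  have hq : 0 < Lam ^ m / m.factorial := by positivity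
  have hmeas : Measurable fun w : Fin p → Fin d → ℝ => ttr m (smat fun j => feat d (w j)) :=
    (ttr_smat_cont p m).measurable.comp
        (measurable_pi_lambda _ fun j => (feat_meas d).comp (measurable_pi_apply j))
  refine (meas_ge_le_lintegral_div hmeas.ennreal_ofReal.aemeasurable (by simpa using hq) ENNReal.ofReal_ne_top).trans ?_
  refine (ENNReal.div_le_div_right hch _).trans ?_
  rw [← ENNReal.ofReal_div_of_pos hq]
  refine ENNReal.ofReal_le_ofReal ?_
  -- numeric part
  have n1 : (1 + 2 * (2 / (d : ℝ) ^ 2)) ^ p ≤ d := by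
    refine le_trans ?_ hd
    calc (1 + 2 * (2 / (d : ℝ) ^ 2)) ^ p ≤ (Real.exp (4 / (d : ℝ) ^ 2)) ^ p := by
          refine pow_le_pow_left₀ (by positivity) ?_ p
          have := Real.add_one_le_exp (4 / (d : ℝ) ^ 2)
          refine le_trans (le_of_eq ?_) this
          ring
      _ = Real.exp (p * (4 / (d : ℝ) ^ 2)) := by rw [← Real.exp_nat_mul]
      _ ≤ _ := by
          refine Real.exp_le_exp.2 ?_
          calc (p : ℝ) * (4 / (d : ℝ) ^ 2) ≤ (C0 * (d : ℝ) ^ 2) * (4 / (d : ℝ) ^ 2) := by gcongr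
            _ = 4 * C0 := by field_simp
  have n2 : (m.factorial : ℝ) / Lam ^ m ≤ (d : ℝ) ^ (-(C + 3)) := by
    have f1 : (m.factorial : ℝ) ≤ (m : ℝ) ^ m := by exact_mod_cast Nat.factorial_le_pow m
    have f2 : (m : ℝ) / Lam ≤ Real.exp (-(C + 3)) := by
      rw [div_le_iff₀ hLpos, hLam, Real.exp_neg]
      have : (0:ℝ) < Real.exp (C + 3) := Real.exp_pos _
      calc (m : ℝ) ≤ 2 * L := hmL2
        _ = _ := by field_simp
    calc (m.factorial : ℝ) / Lam ^ m ≤ (m : ℝ) ^ m / Lam ^ m := by gcongr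
      _ = ((m : ℝ) / Lam) ^ m := by rw [div_pow]
      _ ≤ (Real.exp (-(C + 3))) ^ m := pow_le_pow_left₀ (by positivity) f2 m
      _ = Real.exp (m * (-(C + 3))) := by rw [← Real.exp_nat_mul]
      _ ≤ Real.exp (L * (-(C + 3))) := by
          refine Real.exp_le_exp.2 ?_
          nlinarith
      _ = _ := by rw [Real.rpow_def_of_pos hdpos]
  have n3 : ((Fintype.card (Fin d × Fin d) : ℕ) : ℝ) = (d : ℝ) ^ 2 := by simp [sq]
  rw [n3]
  calc (1 + 2 * (2 / (d : ℝ) ^ 2)) ^ p * (d : ℝ) ^ 2 / (Lam ^ m / m.factorial)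
      = ((1 + 2 * (2 / (d : ℝ) ^ 2)) ^ p * (d : ℝ) ^ 2) * (m.factorial / Lam ^ m) := by
        rw [div_div_eq_mul_div, mul_div_assoc]
    _ ≤ ((d : ℝ) * (d : ℝ) ^ 2) * (d : ℝ) ^ (-(C + 3)) := by gcongr
    _ = (d : ℝ) ^ (3 : ℝ) * (d : ℝ) ^ (-(C + 3)) := by
        congr 1
        rw [show (3 : ℝ) = ((3 : ℕ) : ℝ) by norm_num, Real.rpow_natCast]; ring
    _ = _ := by
        rw [← Real.rpow_add hdpos]; congr 1; ring

theorem kq_bound {d p : ℕ} (hd : 2 ≤ d) (w : Fin p → Fin d → ℝ) (hw : ∀ j, ∑ i, w j i ^ 2 = 1)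
    (Lam : ℝ) (hLam : 0 ≤ Lam)
    (hL : ∀ θ : Fin p → ℝ, ∑ z, (∑ j, θ j * feat d (w j) z) ^ 2 ≤ Lam * ∑ j, θ j ^ 2)
    (θ : Fin p → ℝ) (B c : ℝ) (hB : 0 ≤ B) (hc : 0 ≤ c) (h2 : ∑ j, θ j ^ 2 ≤ B)
    (h0 : kq w 0 θ ≤ B) (h1 : kq w 1 θ ≤ c * B * d) (k : ℕ) :
    kq w (k + 2) θ ≤ (2 * Lam + 1 + c) * B := by
  have hd0 : d ≠ 0 := by omega
  have hdr : (2 : ℝ) ≤ d := by exact_mod_cast hd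
  have hdi : 1 / (d : ℝ) ≤ 1 / 2 := one_div_le_one_div_of_le (by norm_num) hdr
  have hdp : 0 < 1 / (d : ℝ) := by positivity
  have hLB : Lam * ∑ j, θ j ^ 2 ≤ Lam * B := mul_le_mul_of_nonneg_left h2 hLam
  have hLB0 : 0 ≤ Lam * B := by positivity
  have hcB : 0 ≤ c * B := by positivity
  induction k using Nat.strong_induction_on with
  | _ k ih =>
    have hs := kq_step hd0 w hw Lam hL k θ
    match k, ih, hs with
    | 0, _, hs =>
      have : 1 / (d : ℝ) * kq w 0 θ ≤ 1 / d * B := mul_le_mul_of_nonneg_left h0 hdp.le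
      nlinarith
    | 1, _, hs =>
      have : 1 / (d : ℝ) * kq w 1 θ ≤ 1 / d * (c * B * d) := mul_le_mul_of_nonneg_left h1 hdp.le
      have e : 1 / (d : ℝ) * (c * B * d) = c * B := by field_simp
      rw [e] at this
      nlinarith
    | k + 2, ih, hs =>
      have i1 := ih k (by omega)
      have i2 : 1 / (d : ℝ) * kq w (k + 2) θ ≤ 1 / d * ((2 * Lam + 1 + c) * B) :=
        mul_le_mul_of_nonneg_left i1 hdp.le
      have i3 : 1 / (d : ℝ) * ((2 * Lam + 1 + c) * B) ≤ 1 / 2 * ((2 * Lam + 1 + c) * B) :=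
        mul_le_mul_of_nonneg_right hdi (by positivity)
      nlinarith

theorem det_bound (C6 c6 : ℝ) (hC6 : 0 < C6) (hc6' : c6 < 1 / 2) (A K : ℝ) (hA : 0 ≤ A)
    (d p : ℕ) (hd : 2 ≤ d) (hlog : 2 * A + 1 + C6 ^ 2 ≤ Real.log d)
    (w : Fin p → Fin d → ℝ) (hw : ∀ j, ∑ i, w j i ^ 2 = 1)
    (hL : ∀ θ : Fin p → ℝ, ∑ z, (∑ j, θ j * feat d (w j) z) ^ 2 ≤ (A * Real.log d) * ∑ j, θ j ^ 2)
    (μ1 μk : ℝ) (hμ1 : (d : ℝ) ^ (-c6) / C6 ≤ |μ1|) (hμk : |μk| ≤ Real.log d ^ C6)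
    (θ : Fin p → ℝ) (hθ : θ ∈ ThetaPG d p K μ1 w) (k : ℕ) (hk : 2 ≤ k) :
    enorm2 (fun κ : MIdx d k => μk * ∑ j, θ j * qvec d k (w j) κ) ≤ Real.log d ^ (C6 + K + 1) := by
  obtain ⟨-, t2, t3, t4⟩ := hθ
  set L := Real.log d with hLdef
  have hL1 : 1 ≤ L := by nlinarith [sq_nonneg C6]
  have hL0 : 0 < L := by linarith
  have hdr : (2 : ℝ) ≤ d := by exact_mod_cast hd
  have hd0 : (0 : ℝ) < d := by linarith
  have hLK : 0 ≤ L ^ K := Real.rpow_nonneg hL0.le _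
  set B := (L ^ K) ^ 2 with hB
  have hB0 : 0 ≤ B := sq_nonneg _
  have h2 : ∑ j, θ j ^ 2 ≤ B := by
    rw [enorm2, Real.sqrt_le_left hLK] at t2
    exact t2
  have h0 : kq w 0 θ ≤ B := by
    have : kq w 0 θ = (∑ j, θ j) ^ 2 := by
      simp only [kq, pow_zero, mul_one, sq, Finset.sum_mul_sum]
    rw [this]
    exact sq_le_sq' (abs_le.1 t3).1 (abs_le.1 t3).2
  have h1 : kq w 1 θ ≤ C6 ^ 2 * B * d := by
    have e : kq w 1 θ = ∑ i, (∑ j, w j i * θ j) ^ 2 := by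
      have := sum_sq_comb θ w
      simp only [kq, pow_one]
      rw [← this]
      simp only [mul_comm]
    rw [enorm2, Real.sqrt_le_left hLK] at t4
    simp only [mul_pow, ← Finset.mul_sum] at t4
    rw [← e] at t4
    have hk0 : 0 ≤ kq w 1 θ := by rw [e]; exact Finset.sum_nonneg fun _ _ => sq_nonneg _
    have hx : 1 ≤ C6 ^ 2 * d * μ1 ^ 2 := by
      have a1 : ((d : ℝ) ^ (-c6) / C6) ^ 2 ≤ μ1 ^ 2 := by
        rw [← sq_abs μ1]
        exact pow_le_pow_left₀ (by positivity) hμ1 2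
      have a2 : (d : ℝ) ^ (-(1 / 2) : ℝ) ≤ (d : ℝ) ^ (-c6) :=
        Real.rpow_le_rpow_of_exponent_le (by linarith) (by linarith)
      have a3 : ((d : ℝ) ^ (-(1 / 2) : ℝ)) ^ 2 = 1 / d := by
        rw [← Real.rpow_natCast, ← Real.rpow_mul hd0.le]
        norm_num
        rw [Real.rpow_neg_one]
      have a4 : 1 / (d : ℝ) ≤ ((d : ℝ) ^ (-c6)) ^ 2 := by
        rw [← a3]; exact pow_le_pow_left₀ (by positivity) a2 2
      rw [div_pow] at a1
      calc (1 : ℝ) = C6 ^ 2 * d * ((1 / d) / C6 ^ 2) := by field_simp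
        _ ≤ C6 ^ 2 * d * (((d : ℝ) ^ (-c6)) ^ 2 / C6 ^ 2) := by gcongr
        _ ≤ _ := by gcongr
    calc kq w 1 θ = 1 * kq w 1 θ := by ring
      _ ≤ (C6 ^ 2 * d * μ1 ^ 2) * kq w 1 θ := mul_le_mul_of_nonneg_right hx hk0
      _ = C6 ^ 2 * d * (μ1 ^ 2 * kq w 1 θ) := by ring
      _ ≤ C6 ^ 2 * d * B := by gcongr
      _ = _ := by ring
  obtain ⟨k, rfl⟩ : ∃ r, k = r + 2 := ⟨k - 2, by omega⟩
  have hkb := kq_bound hd w hw (A * L) (by positivity) hL θ B (C6 ^ 2) hB0 (by positivity) h2 h0 h1 k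
  have hfin : 2 * (A * L) + 1 + C6 ^ 2 ≤ L ^ 2 := by
    have : 2 * (A * L) + 1 + C6 ^ 2 ≤ (2 * A + 1 + C6 ^ 2) * L := by nlinarith [sq_nonneg C6]
    nlinarith
  rw [enorm2, Real.sqrt_le_left (by positivity)]
  simp only [mul_pow, ← Finset.mul_sum]
  rw [kq_eq]
  have hμ2 : μk ^ 2 ≤ (L ^ C6) ^ 2 := by
    rw [← sq_abs μk]; exact pow_le_pow_left₀ (abs_nonneg _) hμk 2
  calc μk ^ 2 * kq w (k + 2) θ ≤ μk ^ 2 * (L ^ 2 * B) := by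
        refine mul_le_mul_of_nonneg_left (hkb.trans ?_) (sq_nonneg _)
        gcongr
    _ ≤ (L ^ C6) ^ 2 * (L ^ 2 * B) := by gcongr
    _ = _ := by
        rw [Real.rpow_add hL0, Real.rpow_add hL0, Real.rpow_one, hB]; ring

/-- **Proposition B.9**: with high probability over the spherical weights, every
`θ ∈ Θ^PG_W(K)` has bounded chaos projections `‖μ_k V_kᵀ θ‖₂ ≤ (log d)^{K'}` for all
`k = 2, …, D`. -/
theorem bounded_chaos_projections (D : ℕ) (hD : 2 ≤ D) (C0 C6 c6 : ℝ)
    (hC0 : 0 < C0) (hC6 : 0 < C6) (hc6 : 0 < c6) (hc6' : c6 < 1 / 2)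
    (C K : ℝ) (hC : 0 < C) (hK : 0 < K) :
    ∃ K' : ℝ, 0 < K' ∧ ∃ d₀ : ℕ, 0 < d₀ ∧
      ∀ d : ℕ, d₀ ≤ d → ∀ p : ℕ, 1 ≤ p → (p : ℝ) ≤ C0 * (d : ℝ) ^ 2 →
      ∀ μ : ℕ → ℝ,
        (d : ℝ) ^ (-c6) / C6 ≤ |μ 1| → |μ 1| ≤ C6 * (d : ℝ) ^ (-c6) →
        (∀ k : ℕ, 2 ≤ k → k ≤ D → |μ k| ≤ Real.log d ^ C6) →
        1 - ENNReal.ofReal ((d : ℝ) ^ (-C)) ≤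
          (Measure.pi fun _ : Fin p => unifSphere (Fin d))
            {w | ∀ k : ℕ, 2 ≤ k → k ≤ D →
              ∀ θ ∈ ThetaPG d p K (μ 1) w,
                enorm2 (fun κ : MIdx d k => μ k * ∑ j, θ j * qvec d k (w j) κ) ≤
                  Real.log d ^ K'} := by
  set A : ℝ := 2 * Real.exp (C + 3) with hA
  have hApos : 0 < A := by positivity
  refine ⟨C6 + K + 1, by positivity, ⌈Real.exp (4 * C0) + Real.exp (2 * A + 1 + C6 ^ 2) + 2⌉₊, ?_, ?_⟩
  · exact Nat.ceil_pos.2 (by positivity)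
  intro d hd p _ hp μ hμ1 _ hμk
  have hd' : Real.exp (4 * C0) + Real.exp (2 * A + 1 + C6 ^ 2) + 2 ≤ d :=
    (Nat.le_ceil _).trans (by exact_mod_cast hd)
  have e1 := Real.exp_pos (4 * C0)
  have e2 := Real.exp_pos (2 * A + 1 + C6 ^ 2)
  have hd2 : 2 ≤ d := by
    have : (2 : ℝ) ≤ d := by linarith
    exact_mod_cast this
  have hdpos : (0 : ℝ) < d := by linarith
  have hlog : 2 * A + 1 + C6 ^ 2 ≤ Real.log d := by
    rw [Real.le_log_iff_exp_le hdpos]; linarith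
  have hlog1 : 1 ≤ Real.log d := by nlinarith [sq_nonneg C6]
  have hev := prob_event C0 C hC0 hC d p (by linarith) hlog1 hp
  set P := (Measure.pi fun _ : Fin p => unifSphere (Fin d)) with hP
  set G : Set (Fin p → Fin d → ℝ) := {w | ∀ k : ℕ, 2 ≤ k → k ≤ D →
              ∀ θ ∈ ThetaPG d p K (μ 1) w,
                enorm2 (fun κ : MIdx d k => μ k * ∑ j, θ j * qvec d k (w j) κ) ≤
                  Real.log d ^ (C6 + K + 1)} with hG
  have hGc : P Gᶜ ≤ ENNReal.ofReal ((d : ℝ) ^ (-C)) := by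
    refine (measure_mono ?_).trans hev
    intro w hw hgood
    refine hw fun k hk hkD θ hθ => ?_
    exact det_bound C6 c6 hC6 hc6' A K hApos.le d p hd2 hlog w hgood.1 hgood.2 (μ 1) (μ k) hμ1
      (hμk k hk hkD) θ hθ k hk
  have huniv : (1 : ENNReal) ≤ P G + P Gᶜ := by
    have h1 : P Set.univ = 1 := measure_univ
    rw [← h1, ← Set.union_compl_self G]
    exact measure_union_le _ _
  rw [tsub_le_iff_right]
  exact huniv.trans (by gcongr)
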